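/- arXiv:2005.04778 — 2 statements merged into one kernel-verified Lean document; each statement's English description precedes it below -/
import Mathlib

section
/- Let C be a preadditive category, I a set, and A an object of C such that the coproduct ∐_{i∈I} A exists. Let f : A → ∐_{i∈I} A be a decomposing morphism, fix j ∈ I, and suppose e : E → A is an equalizer of f and the coprojection ι_j. Then this equalizer is split: there exist morphisms p : ∐_{i∈I} A → A and s : A → E with s ∘ e = id_E, p ∘ ι_j = id_A, and p ∘ f = e ∘ s. -/
open CategoryTheory CategoryTheory.Limits

universe v u w

/-- In a preadditive category, the equalizer of a decomposing morphism
`f : A ⟶ ∐_{i ∈ I} A` and a coprojection `ι_j` is split. -/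
theorem decomposing_equalizer_split
    {C : Type u} [Category.{v} C] [Preadditive C]
    {I : Type w} {A : C}
    [HasCoproduct (fun _ : I => A)]
    [HasCoproduct (fun _ : I => (∐ fun _ : I => A))]
    (f : A ⟶ ∐ fun _ : I => A)
    (hdec₁ : f ≫ Limits.Sigma.map (fun _ : I => f) =
      f ≫ Limits.Sigma.map (fun i : I => Limits.Sigma.ι (fun _ : I => A) i))
    (hdec₂ : f ≫ Limits.Sigma.desc (fun _ : I => 𝟙 A) = 𝟙 A)
    (j : I) {E : C} (e : E ⟶ A)
    (w : e ≫ f = e ≫ Limits.Sigma.ι (fun _ : I => A) j)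
    (hl : IsLimit (Fork.ofι e w)) :
    ∃ (p : (∐ fun _ : I => A) ⟶ A) (s : A ⟶ E),
      e ≫ s = 𝟙 E ∧ Limits.Sigma.ι (fun _ : I => A) j ≫ p = 𝟙 A ∧ f ≫ p = s ≫ e := by
  classical
  let p : (∐ fun _ : I => A) ⟶ A := Limits.Sigma.desc (fun i : I => if i = j then 𝟙 A else 0)
  let q : (∐ fun _ : I => (∐ fun _ : I => A)) ⟶ (∐ fun _ : I => A) :=
    Limits.Sigma.desc (fun i : I => if i = j then 𝟙 _ else 0)
  have hp : Limits.Sigma.ι (fun _ : I => A) j ≫ p = 𝟙 A := by simp [p]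
  have h1 : Limits.Sigma.map (fun _ : I => f) ≫ q = p ≫ f := by
    apply Limits.Sigma.hom_ext
    intro i
    by_cases h : i = j <;> simp [p, q, h]
  have h2 : Limits.Sigma.map (fun i : I => Limits.Sigma.ι (fun _ : I => A) i) ≫ q =
      p ≫ Limits.Sigma.ι (fun _ : I => A) j := by
    apply Limits.Sigma.hom_ext
    intro i
    by_cases h : i = j
    · subst h
      simp [p, q]
    · simp [p, q, h]
  have h3 : (f ≫ p) ≫ f = (f ≫ p) ≫ Limits.Sigma.ι (fun _ : I => A) j := by
    rw [Category.assoc, Category.assoc, ← h1, ← h2, ← Category.assoc, hdec₁, Category.assoc]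
  obtain ⟨s, hs⟩ := Fork.IsLimit.lift' hl (f ≫ p) h3
  have hs' : s ≫ e = f ≫ p := hs
  refine ⟨p, s, ?_, hp, hs'.symm⟩
  apply Fork.IsLimit.hom_ext hl
  change (e ≫ s) ≫ e = 𝟙 E ≫ e
  rw [Category.assoc, hs', ← Category.assoc, w, Category.assoc, hp, Category.comp_id,
    Category.id_comp]
end

section
/- Let C be a category, I a set, and A an object of C such that the coproducts ∐_{i∈I} A and ∐_{i∈I}(∐_{j∈I} A) exist. Let f : A → ∐_{i∈I} A be a decomposing morphism. Then the diagram A →f→ ∐_{i∈I} A ⇉ ∐_{i∈I}(∐_{j∈I} A), with parallel arrows ∐_{i∈I} f and ∐_{i∈I} ι_i, is a split equalizer: taking s = ∇ : ∐_{i∈I} A → A and p : ∐_{i∈I}(∐_{j∈I} A) → ∐_{j∈I} A the codiagonal collapsing the outer index, one has ∇ ∘ f = id_A, p ∘ (∐_{i∈I} ι_i) = id, and p ∘ (∐_{i∈I} f) = f ∘ ∇. In particular, f is an equalizer of ∐_{i∈I} f and ∐_{i∈I} ι_i, and this equalizer is preserved by every functor. -/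
open CategoryTheory CategoryTheory.Limits

universe v u v₂ u₂ w

/-- A decomposing morphism `f : A ⟶ ∐_{i ∈ I} A` gives rise to a split equalizer diagram
`A ⟶ ∐_{i∈I} A ⇉ ∐_{i∈I} ∐_{j∈I} A` (parallel arrows `∐ᵢ f` and `∐ᵢ ιᵢ`), split by the
codiagonal `∇` and the codiagonal `p` collapsing the outer index.  In particular `f` is
an equalizer of `∐ᵢ f` and `∐ᵢ ιᵢ`, and this equalizer is preserved by every functor. -/
theorem decomposing_split_equalizer
    {C : Type u} [Category.{v} C] {I : Type w} {A : C}
    [HasCoproduct (fun _ : I => A)]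
    [HasCoproduct (fun _ : I => (∐ fun _ : I => A))]
    (f : A ⟶ ∐ fun _ : I => A)
    (hdec₁ : f ≫ Limits.Sigma.map (fun _ : I => f) =
      f ≫ Limits.Sigma.map (fun i : I => Limits.Sigma.ι (fun _ : I => A) i))
    (hdec₂ : f ≫ Limits.Sigma.desc (fun _ : I => 𝟙 A) = 𝟙 A) :
    (Limits.Sigma.map (fun i : I => Limits.Sigma.ι (fun _ : I => A) i) ≫
        Limits.Sigma.desc (fun _ : I => 𝟙 (∐ fun _ : I => A)) = 𝟙 _) ∧
    (Limits.Sigma.map (fun _ : I => f) ≫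
        Limits.Sigma.desc (fun _ : I => 𝟙 (∐ fun _ : I => A)) =
      Limits.Sigma.desc (fun _ : I => 𝟙 A) ≫ f) ∧
    Nonempty (IsLimit (Fork.ofι f hdec₁)) ∧
    (∀ {D : Type u₂} [Category.{v₂} D] (G : C ⥤ D),
      Nonempty (IsLimit (Fork.ofι (G.map f)
        (show G.map f ≫ G.map (Limits.Sigma.map (fun _ : I => f)) =
            G.map f ≫ G.map (Limits.Sigma.map (fun i : I => Limits.Sigma.ι (fun _ : I => A) i))
          by rw [← G.map_comp, ← G.map_comp, hdec₁])))) := by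
  have h1 : Limits.Sigma.map (fun i : I => Limits.Sigma.ι (fun _ : I => A) i) ≫
        Limits.Sigma.desc (fun _ : I => 𝟙 (∐ fun _ : I => A)) = 𝟙 _ := by
    apply Limits.Sigma.hom_ext
    intro i
    simp
  have h2 : Limits.Sigma.map (fun _ : I => f) ≫
        Limits.Sigma.desc (fun _ : I => 𝟙 (∐ fun _ : I => A)) =
      Limits.Sigma.desc (fun _ : I => 𝟙 A) ≫ f := by
    apply Limits.Sigma.hom_ext
    intro i
    simp
  let q : IsSplitEqualizer (Limits.Sigma.map (fun _ : I => f))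
      (Limits.Sigma.map (fun i : I => Limits.Sigma.ι (fun _ : I => A) i)) f :=
    { leftRetraction := Limits.Sigma.desc (fun _ : I => 𝟙 A)
      rightRetraction := Limits.Sigma.desc (fun _ : I => 𝟙 (∐ fun _ : I => A))
      condition := hdec₁
      ι_leftRetraction := hdec₂
      bottom_rightRetraction := h1
      top_rightRetraction := h2 }
  exact ⟨h1, h2, ⟨q.isEqualizer⟩, fun G => ⟨(q.map G).isEqualizer⟩⟩
end
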